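/- arXiv:0802.1859 — 14 statements merged into one kernel-verified Lean document; each statement's English description precedes it below -/
import Mathlib

section
/- Let X be a set with a binary operation *, and let 𝒰 and 𝒱 be inclusion hyperspaces on X. Then for a subset A ⊆ X the following are equivalent: (i) {x ∈ X : x⁻¹A ∈ 𝒱} ∈ 𝒰; (ii) there exist a set U ∈ 𝒰 and a family of sets (V_x)_{x∈U} with each V_x ∈ 𝒱 such that ⋃_{x∈U} x*V_x ⊆ A. Consequently the induced operation 𝒰 ∘ 𝒱 = {A ⊆ X : {x ∈ X : x⁻¹A ∈ 𝒱} ∈ 𝒰} coincides with the inclusion hyperspace generated by the base {⋃_{x∈U} x*V_x : U ∈ 𝒰, (V_x)_{x∈U} ⊆ 𝒱}. -/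
variable {X : Type*}

/-- An inclusion hyperspace on a set `X`: a nonempty family of nonempty subsets of `X`
that is monotone (closed under taking supersets). -/
def IsIH (𝒜 : Set (Set X)) : Prop :=
  𝒜.Nonempty ∧ (∀ A ∈ 𝒜, A.Nonempty) ∧ ∀ A ∈ 𝒜, ∀ B : Set X, A ⊆ B → B ∈ 𝒜

theorem stmt0 (op : X → X → X) (𝒰 𝒱 : Set (Set X))
    (h𝒰 : IsIH 𝒰) (h𝒱 : IsIH 𝒱) :
    (∀ A : Set X,
      ({x | {y | op x y ∈ A} ∈ 𝒱} ∈ 𝒰) ↔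
      (∃ U ∈ 𝒰, ∃ V : X → Set X, (∀ x ∈ U, V x ∈ 𝒱) ∧
        (⋃ x ∈ U, (op x) '' (V x)) ⊆ A)) ∧
    {A : Set X | {x | {y | op x y ∈ A} ∈ 𝒱} ∈ 𝒰} =
      {A : Set X | ∃ U ∈ 𝒰, ∃ V : X → Set X, (∀ x ∈ U, V x ∈ 𝒱) ∧
        (⋃ x ∈ U, (op x) '' (V x)) ⊆ A} := by
  have key : ∀ A : Set X,
      ({x | {y | op x y ∈ A} ∈ 𝒱} ∈ 𝒰) ↔
      (∃ U ∈ 𝒰, ∃ V : X → Set X, (∀ x ∈ U, V x ∈ 𝒱) ∧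
        (⋃ x ∈ U, (op x) '' (V x)) ⊆ A) := by
    intro A
    constructor
    · intro h
      refine ⟨_, h, fun x => {y | op x y ∈ A}, fun x hx => hx, ?_⟩
      exact Set.iUnion₂_subset fun x _ => Set.image_subset_iff.2 fun y hy => hy
    · rintro ⟨U, hU, V, hV, hA⟩
      refine h𝒰.2.2 U hU _ fun x hx => h𝒱.2.2 (V x) (hV x hx) _ ?_
      exact Set.image_subset_iff.1 (Set.iUnion₂_subset_iff.1 hA x hx)
  exact ⟨key, Set.ext key⟩
end

section
/- Let X be a set with a binary operation *. For any inclusion hyperspaces 𝒰 and 𝒱 on X, the transversality operation commutes with the induced operation: (𝒰 ∘ 𝒱)⊥ = 𝒰⊥ ∘ 𝒱⊥. -/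
variable {X : Type*}

/-- The operation on inclusion hyperspaces induced by a binary operation on `X`. -/
def circ (op : X → X → X) (𝒰 𝒱 : Set (Set X)) : Set (Set X) :=
  {A | {x | {y | op x y ∈ A} ∈ 𝒱} ∈ 𝒰}

/-- The transversality of an inclusion hyperspace. -/
def perp (𝒜 : Set (Set X)) : Set (Set X) :=
  {A | ∀ B ∈ 𝒜, (A ∩ B).Nonempty}

/-- For a monotone family, a set is transversal to it iff its complement is not a member. -/
theorem mem_perp_iff_compl_notMem {𝒜 : Set (Set X)}
    (h : ∀ A ∈ 𝒜, ∀ B : Set X, A ⊆ B → B ∈ 𝒜) (A : Set X) :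
    A ∈ perp 𝒜 ↔ Aᶜ ∉ 𝒜 := by
  constructor
  · intro hA hc
    simpa using hA _ hc
  · intro hc B hB
    by_contra hne
    exact hc (h B hB _ fun x hx hxA => hne ⟨x, hxA, hx⟩)

theorem circ_mono (op : X → X → X) {𝒰 𝒱 : Set (Set X)}
    (h𝒰 : ∀ A ∈ 𝒰, ∀ B : Set X, A ⊆ B → B ∈ 𝒰)
    (h𝒱 : ∀ A ∈ 𝒱, ∀ B : Set X, A ⊆ B → B ∈ 𝒱) :
    ∀ A ∈ circ op 𝒰 𝒱, ∀ B : Set X, A ⊆ B → B ∈ circ op 𝒰 𝒱 :=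
  fun _ hA _ hAB => h𝒰 _ hA _ fun _ hx => h𝒱 _ hx _ fun _ hy => hAB hy

theorem stmt1 (op : X → X → X) (𝒰 𝒱 : Set (Set X))
    (h𝒰 : IsIH 𝒰) (h𝒱 : IsIH 𝒱) :
    perp (circ op 𝒰 𝒱) = circ op (perp 𝒰) (perp 𝒱) := by
  ext A
  rw [mem_perp_iff_compl_notMem (circ_mono op h𝒰.2.2 h𝒱.2.2)]
  simp only [circ, Set.mem_ofPred_eq, mem_perp_iff_compl_notMem h𝒰.2.2,
    mem_perp_iff_compl_notMem h𝒱.2.2, Set.compl_ofPred, not_not, Set.mem_compl_iff]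
end

section
/- Let X be a set with a binary operation * and let k ≥ 2 be a natural number. If 𝒰 and 𝒱 are inclusion hyperspaces on X that are both filters, then 𝒰 ∘ 𝒱 is a filter; if 𝒰 and 𝒱 are both k-linked, then 𝒰 ∘ 𝒱 is k-linked; if 𝒰 and 𝒱 are both centered, then 𝒰 ∘ 𝒱 is centered. -/
variable {X : Type*}

/-- A family of sets is a filter (in the sense of inclusion hyperspaces) if it
is closed under binary intersections. -/
def IsFilterIH (𝒜 : Set (Set X)) : Prop :=
  ∀ A₁ ∈ 𝒜, ∀ A₂ ∈ 𝒜, A₁ ∩ A₂ ∈ 𝒜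

/-- A family of sets is `k`-linked if every subfamily with at most `k` members
has nonempty intersection. -/
def IsKLinked (k : ℕ) (𝒜 : Set (Set X)) : Prop :=
  ∀ S : Finset (Set X), ↑S ⊆ 𝒜 → S.card ≤ k → (⋂₀ (S : Set (Set X))).Nonempty

/-- A family of sets is centered if every finite subfamily has nonempty intersection. -/
def IsCentered (𝒜 : Set (Set X)) : Prop :=
  ∀ S : Finset (Set X), ↑S ⊆ 𝒜 → (⋂₀ (S : Set (Set X))).Nonempty

/-- A finite subfamily `S` of `circ op 𝒰 𝒱` has nonempty intersection as soon as every subfamily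
of `𝒰` and every subfamily of `𝒱` with at most `S.card` members does. -/
theorem nonempty_sInter_of_subset_circ (op : X → X → X) {𝒰 𝒱 : Set (Set X)}
    (S : Finset (Set X)) (hS : ↑S ⊆ circ op 𝒰 𝒱)
    (h𝒰 : ∀ T : Finset (Set X), ↑T ⊆ 𝒰 → T.card ≤ S.card → (⋂₀ (T : Set (Set X))).Nonempty)
    (h𝒱 : ∀ T : Finset (Set X), ↑T ⊆ 𝒱 → T.card ≤ S.card → (⋂₀ (T : Set (Set X))).Nonempty) :
    (⋂₀ (S : Set (Set X))).Nonempty := by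
  classical
  obtain ⟨x, hx⟩ := h𝒰 (S.image fun A => {x | {y | op x y ∈ A} ∈ 𝒱})
    (by
      intro B hB
      obtain ⟨A, hA, rfl⟩ := Finset.mem_image.mp (Finset.mem_coe.mp hB)
      exact hS hA)
    Finset.card_image_le
  obtain ⟨y, hy⟩ := h𝒱 (S.image fun A => {y | op x y ∈ A})
    (by
      intro B hB
      obtain ⟨A, hA, rfl⟩ := Finset.mem_image.mp (Finset.mem_coe.mp hB)
      exact hx _ (Finset.mem_coe.mpr (Finset.mem_image_of_mem _ hA)))
    Finset.card_image_le
  exact ⟨op x y, fun A hA => hy _ (Finset.mem_coe.mpr (Finset.mem_image_of_mem _ hA))⟩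

theorem stmt6 (op : X → X → X) (k : ℕ) (hk : 2 ≤ k)
    (𝒰 𝒱 : Set (Set X)) (h𝒰 : IsIH 𝒰) (h𝒱 : IsIH 𝒱) :
    (IsFilterIH 𝒰 → IsFilterIH 𝒱 → IsFilterIH (circ op 𝒰 𝒱)) ∧
    (IsKLinked k 𝒰 → IsKLinked k 𝒱 → IsKLinked k (circ op 𝒰 𝒱)) ∧
    (IsCentered 𝒰 → IsCentered 𝒱 → IsCentered (circ op 𝒰 𝒱)) := by
  refine ⟨fun hU hV A hA B hB => ?_, fun hU hV S hS hcard => ?_, fun hU hV S hS => ?_⟩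
  · exact h𝒰.2.2 _ (hU _ hA _ hB) _ fun x hx => hV _ hx.1 _ hx.2
  · exact nonempty_sInter_of_subset_circ op S hS
      (fun T hT h => hU T hT (h.trans hcard)) (fun T hT h => hV T hT (h.trans hcard))
  · exact nonempty_sInter_of_subset_circ op S hS
      (fun T hT _ => hU T hT) (fun T hT _ => hV T hT)
end

section
/- Let X be a set with a binary operation *. If 𝒰 and 𝒱 are inclusion hyperspaces on X that are both ultrafilters, then 𝒰 ∘ 𝒱 is an ultrafilter; if 𝒰 and 𝒱 are both maximal linked, then 𝒰 ∘ 𝒱 is maximal linked. -/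
variable {X : Type*}

/-- An inclusion hyperspace is an ultrafilter if it is a filter maximal among
filter inclusion hyperspaces. -/
def IsUltraIH (𝒜 : Set (Set X)) : Prop :=
  IsFilterIH 𝒜 ∧
    ∀ 𝒜' : Set (Set X), IsIH 𝒜' → IsFilterIH 𝒜' → 𝒜 ⊆ 𝒜' → 𝒜 = 𝒜'

/-- A family of sets is linked if any two of its members intersect. -/
def IsLinked (𝒜 : Set (Set X)) : Prop :=
  ∀ A ∈ 𝒜, ∀ B ∈ 𝒜, (A ∩ B).Nonempty

/-- An inclusion hyperspace is maximal linked if it is linked and maximal among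
linked inclusion hyperspaces. -/
def IsMaxLinked (𝒜 : Set (Set X)) : Prop :=
  IsLinked 𝒜 ∧
    ∀ 𝒜' : Set (Set X), IsIH 𝒜' → IsLinked 𝒜' → 𝒜 ⊆ 𝒜' → 𝒜 = 𝒜'

theorem IsIH.isLinked_of_isFilterIH {𝒜 : Set (Set X)} (h : IsIH 𝒜) (hf : IsFilterIH 𝒜) :
    IsLinked 𝒜 :=
  fun A hA B hB => h.2.1 _ (hf A hA B hB)

/-- If `Aᶜ` is not a member of an inclusion hyperspace, then `A` meets all its members. -/
theorem IsIH.inter_nonempty_of_compl_notMem {𝒜 : Set (Set X)} (h : IsIH 𝒜) {A B : Set X}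
    (hA : Aᶜ ∉ 𝒜) (hB : B ∈ 𝒜) : (B ∩ A).Nonempty := by
  by_contra hne
  refine hA (h.2.2 B hB _ fun x hxB hxA => hne ⟨x, hxB, hxA⟩)

theorem IsUltraIH.mem_or_compl_mem {𝒜 : Set (Set X)} (h : IsIH 𝒜) (hu : IsUltraIH 𝒜)
    (A : Set X) : A ∈ 𝒜 ∨ Aᶜ ∈ 𝒜 := by
  by_contra! hA
  have hsub : 𝒜 ⊆ {C | ∃ B ∈ 𝒜, B ∩ A ⊆ C} := fun B hB => ⟨B, hB, Set.inter_subset_left⟩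
  have heq := hu.2 {C | ∃ B ∈ 𝒜, B ∩ A ⊆ C} ⟨h.1.mono hsub, ?_, ?_⟩ ?_ hsub
  · obtain ⟨B, hB⟩ := h.1
    refine hA.1 ?_
    rw [heq]
    exact ⟨B, hB, Set.inter_subset_right⟩
  · rintro C ⟨B, hB, hBC⟩
    exact (h.inter_nonempty_of_compl_notMem hA.2 hB).mono hBC
  · rintro C ⟨B, hB, hBC⟩ D hCD
    exact ⟨B, hB, hBC.trans hCD⟩
  · rintro C ⟨B, hB, hBC⟩ C' ⟨B', hB', hBC'⟩
    exact ⟨B ∩ B', hu.1 B hB B' hB',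
      fun x hx => ⟨hBC ⟨hx.1.1, hx.2⟩, hBC' ⟨hx.1.2, hx.2⟩⟩⟩

theorem IsMaxLinked.mem_or_compl_mem {𝒜 : Set (Set X)} (h : IsIH 𝒜) (hm : IsMaxLinked 𝒜)
    (A : Set X) : A ∈ 𝒜 ∨ Aᶜ ∈ 𝒜 := by
  by_contra! hA
  have hmeet : ∀ B ∈ 𝒜, (B ∩ A).Nonempty := fun B hB =>
    h.inter_nonempty_of_compl_notMem hA.2 hB
  have hne : A.Nonempty := h.1.elim fun B hB => (hmeet B hB).mono Set.inter_subset_right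
  have hsub : 𝒜 ⊆ 𝒜 ∪ {C | A ⊆ C} := Set.subset_union_left
  have heq := hm.2 (𝒜 ∪ {C | A ⊆ C}) ⟨h.1.mono hsub, ?_, ?_⟩ ?_ hsub
  · refine hA.1 ?_
    rw [heq]
    exact Or.inr (Set.Subset.refl A)
  · rintro C (hC | hC)
    · exact h.2.1 C hC
    · exact hne.mono hC
  · rintro C (hC | hC) D hCD
    · exact Or.inl (h.2.2 C hC D hCD)
    · exact Or.inr (Set.Subset.trans hC hCD)
  · rintro C (hC | hC) D (hD | hD)
    · exact hm.1 C hC D hD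
    · exact (hmeet C hC).mono (Set.inter_subset_inter_right C hD)
    · rw [Set.inter_comm]
      exact (hmeet D hD).mono (Set.inter_subset_inter_right D hC)
    · exact hne.mono (Set.subset_inter hC hD)

/-- A family containing each set or its complement contains every linked family above it. -/
theorem IsLinked.eq_of_subset_of_mem_or_compl_mem {𝒜 𝒜' : Set (Set X)} (hl : IsLinked 𝒜')
    (hsub : 𝒜 ⊆ 𝒜') (h : ∀ A, A ∈ 𝒜 ∨ Aᶜ ∈ 𝒜) : 𝒜 = 𝒜' := by
  refine hsub.antisymm fun A hA => (h A).resolve_right fun hAc => ?_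
  obtain ⟨x, hx, hxc⟩ := hl A hA _ (hsub hAc)
  exact hxc hx

theorem circ_mem_or_compl_mem (op : X → X → X) {𝒰 𝒱 : Set (Set X)} (h𝒰 : IsIH 𝒰)
    (hu : ∀ A, A ∈ 𝒰 ∨ Aᶜ ∈ 𝒰) (hv : ∀ A, A ∈ 𝒱 ∨ Aᶜ ∈ 𝒱) (A : Set X) :
    A ∈ circ op 𝒰 𝒱 ∨ Aᶜ ∈ circ op 𝒰 𝒱 :=
  (hu {x | {y | op x y ∈ A} ∈ 𝒱}).imp id fun h =>
    h𝒰.2.2 _ h _ fun x hx => (hv {y | op x y ∈ A}).resolve_left hx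

theorem IsFilterIH.circ (op : X → X → X) {𝒰 𝒱 : Set (Set X)} (h𝒰 : IsIH 𝒰)
    (hu : IsFilterIH 𝒰) (hv : IsFilterIH 𝒱) : IsFilterIH (circ op 𝒰 𝒱) :=
  fun _ hA _ hB => h𝒰.2.2 _ (hu _ hA _ hB) _ fun _ hx => hv _ hx.1 _ hx.2

theorem IsLinked.circ (op : X → X → X) {𝒰 𝒱 : Set (Set X)}
    (hu : IsLinked 𝒰) (hv : IsLinked 𝒱) : IsLinked (circ op 𝒰 𝒱) := by
  intro A hA B hB
  obtain ⟨x, hxA, hxB⟩ := hu _ hA _ hB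
  obtain ⟨y, hyA, hyB⟩ := hv _ hxA _ hxB
  exact ⟨op x y, hyA, hyB⟩

theorem stmt7 (op : X → X → X) (𝒰 𝒱 : Set (Set X))
    (h𝒰 : IsIH 𝒰) (h𝒱 : IsIH 𝒱) :
    (IsUltraIH 𝒰 → IsUltraIH 𝒱 → IsUltraIH (circ op 𝒰 𝒱)) ∧
    (IsMaxLinked 𝒰 → IsMaxLinked 𝒱 → IsMaxLinked (circ op 𝒰 𝒱)) := by
  refine ⟨fun hu hv => ⟨hu.1.circ op h𝒰 hv.1, fun 𝒜' h hf hsub => ?_⟩,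
    fun hu hv => ⟨hu.1.circ op hv.1, fun 𝒜' _ hl hsub => ?_⟩⟩
  · exact (h.isLinked_of_isFilterIH hf).eq_of_subset_of_mem_or_compl_mem hsub
      (circ_mem_or_compl_mem op h𝒰 (hu.mem_or_compl_mem h𝒰) (hv.mem_or_compl_mem h𝒱))
  · exact hl.eq_of_subset_of_mem_or_compl_mem hsub
      (circ_mem_or_compl_mem op h𝒰 (hu.mem_or_compl_mem h𝒰) (hv.mem_or_compl_mem h𝒱))
end

section
/- Let X be a set with a binary operation *. If 𝒰 and 𝒱 are inclusion hyperspaces on X with finite support, then 𝒰 ∘ 𝒱 has finite support. -/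
variable {X : Type*}

/-- An inclusion hyperspace has finite support if it is generated by a finite
nonempty family of finite nonempty sets. -/
def HasFiniteSupport (𝒜 : Set (Set X)) : Prop :=
  ∃ ℱ : Set (Set X), ℱ.Finite ∧ ℱ.Nonempty ∧
    (∀ F ∈ ℱ, F.Finite ∧ F.Nonempty) ∧
    𝒜 = {A : Set X | ∃ F ∈ ℱ, F ⊆ A}

/-- Membership in the product of two families in terms of generating families. -/
theorem mem_circ_generated_iff (op : X → X → X) (ℱ 𝒢 : Set (Set X)) (A : Set X) :
    A ∈ circ op {A | ∃ F ∈ ℱ, F ⊆ A} {A | ∃ G ∈ 𝒢, G ⊆ A} ↔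
      ∃ F ∈ ℱ, ∀ x ∈ F, ∃ G ∈ 𝒢, ∀ y ∈ G, op x y ∈ A :=
  Iff.rfl

theorem stmt8 (op : X → X → X) (𝒰 𝒱 : Set (Set X))
    (h𝒰 : IsIH 𝒰) (h𝒱 : IsIH 𝒱)
    (hf𝒰 : HasFiniteSupport 𝒰) (hf𝒱 : HasFiniteSupport 𝒱) :
    HasFiniteSupport (circ op 𝒰 𝒱) := by
  obtain ⟨ℱ, hℱ, ⟨F₀, hF₀⟩, hℱ', rfl⟩ := hf𝒰
  obtain ⟨𝒢, h𝒢, ⟨G₀, hG₀⟩, h𝒢', rfl⟩ := hf𝒱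
  have hfin : (Set.image2 op (⋃₀ ℱ) (⋃₀ 𝒢)).Finite :=
    (hℱ.sUnion fun F hF => (hℱ' F hF).1).image2 op (h𝒢.sUnion fun G hG => (h𝒢' G hG).1)
  have hmem {F G : Set X} (hF : F ∈ ℱ) (hG : G ∈ 𝒢) {x y : X} (hx : x ∈ F) (hy : y ∈ G) :
      op x y ∈ Set.image2 op (⋃₀ ℱ) (⋃₀ 𝒢) :=
    Set.mem_image2_of_mem ⟨F, hF, hx⟩ ⟨G, hG, hy⟩
  refine ⟨{B | B ⊆ Set.image2 op (⋃₀ ℱ) (⋃₀ 𝒢) ∧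
      B ∈ circ op {A | ∃ F ∈ ℱ, F ⊆ A} {A | ∃ G ∈ 𝒢, G ⊆ A}},
    hfin.finite_subsets.subset fun B hB => hB.1, ⟨_, subset_rfl, ?_⟩, ?_, ?_⟩
  · rw [mem_circ_generated_iff]
    exact ⟨F₀, hF₀, fun x hx => ⟨G₀, hG₀, fun y hy => hmem hF₀ hG₀ hx hy⟩⟩
  · rintro B ⟨hB, hBc⟩
    rw [mem_circ_generated_iff] at hBc
    obtain ⟨F, hF, h⟩ := hBc
    obtain ⟨x, hx⟩ := (hℱ' F hF).2
    obtain ⟨G, hG, h⟩ := h x hx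
    obtain ⟨y, hy⟩ := (h𝒢' G hG).2
    exact ⟨hfin.subset hB, op x y, h y hy⟩
  · ext A
    constructor
    · intro hA
      refine ⟨A ∩ Set.image2 op (⋃₀ ℱ) (⋃₀ 𝒢), ⟨Set.inter_subset_right, ?_⟩,
        Set.inter_subset_left⟩
      rw [mem_circ_generated_iff] at hA ⊢
      obtain ⟨F, hF, h⟩ := hA
      refine ⟨F, hF, fun x hx => ?_⟩
      obtain ⟨G, hG, h⟩ := h x hx
      exact ⟨G, hG, fun y hy => ⟨h y hy, hmem hF hG hx hy⟩⟩
    · rintro ⟨B, ⟨-, hB⟩, hBA⟩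
      rw [mem_circ_generated_iff] at hB ⊢
      obtain ⟨F, hF, h⟩ := hB
      refine ⟨F, hF, fun x hx => ?_⟩
      obtain ⟨G, hG, h⟩ := h x hx
      exact ⟨G, hG, fun y hy => hBA (h y hy)⟩
end

section
/- Let X be a set with a binary operation * such that for each b ∈ X there is a finite subset F ⊆ X such that for every a ∈ X \ F the set a⁻¹b = {x ∈ X : a*x = b} is finite. If 𝒜 and 𝒝 are free inclusion hyperspaces on X, then 𝒜 ∘ 𝒝 is a free inclusion hyperspace. -/
variable {X : Type*}

/-- An inclusion hyperspace is free if each of its members can be shrunk to a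
member avoiding any given finite set. -/
def IsFree (𝒜 : Set (Set X)) : Prop :=
  ∀ K : Set X, K.Finite → ∀ F ∈ 𝒜, ∃ E ∈ 𝒜, E ⊆ F \ K

theorem stmt9 (op : X → X → X)
    (hcond : ∀ b : X, ∃ F : Set X, F.Finite ∧
      ∀ a ∉ F, {x : X | op a x = b}.Finite)
    (𝒜 𝒝 : Set (Set X)) (h𝒜 : IsIH 𝒜) (h𝒝 : IsIH 𝒝)
    (hf𝒜 : IsFree 𝒜) (hf𝒝 : IsFree 𝒝) :
    IsFree (circ op 𝒜 𝒝) := by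
  choose F hF hfin using hcond
  intro K hK A hA
  refine ⟨A \ K, ?_, subset_rfl⟩
  obtain ⟨E, hE, hEA⟩ := hf𝒜 (⋃ b ∈ K, F b) (hK.biUnion fun b _ => hF b) _ hA
  refine h𝒜.2.2 E hE _ fun x hx => ?_
  obtain ⟨hxA, hxF⟩ := hEA hx
  have hxK : {y | op x y ∈ K}.Finite := by
    have h : {y | op x y ∈ K} = ⋃ b ∈ K, {y | op x y = b} := by
      ext y
      simp
    rw [h]
    exact hK.biUnion fun b hb => hfin b x fun hxb => hxF (Set.mem_biUnion hb hxb)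
  obtain ⟨G, hG, hGA⟩ := hf𝒝 _ hxK _ hxA
  exact h𝒝.2.2 G hG _ hGA
end

section
/- Let X be a set with a binary operation *. An inclusion hyperspace 𝒜 on X is a right zero of the induced operation ∘ (that is, 𝒝 ∘ 𝒜 = 𝒜 for every inclusion hyperspace 𝒝 on X) if and only if 𝒜 is shift-invariant. -/
variable {X : Type*}

/-- An inclusion hyperspace is shift-invariant if it is closed under left shifts
`x*A` and preimage shifts `x⁻¹A`. -/
def ShiftInv (op : X → X → X) (𝒜 : Set (Set X)) : Prop :=
  ∀ A ∈ 𝒜, ∀ x : X, (op x) '' A ∈ 𝒜 ∧ {y : X | op x y ∈ A} ∈ 𝒜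

theorem shiftInv_iff_forall_preimage_mem_iff (op : X → X → X) (𝒜 : Set (Set X))
    (h𝒜 : IsIH 𝒜) :
    ShiftInv op 𝒜 ↔ ∀ (A : Set X) (x : X), {y | op x y ∈ A} ∈ 𝒜 ↔ A ∈ 𝒜 := by
  obtain ⟨-, -, hmono⟩ := h𝒜
  constructor
  · exact fun h A x =>
      ⟨fun hA => hmono _ (h _ hA x).1 A (Set.image_subset_iff.2 subset_rfl),
        fun hA => (h A hA x).2⟩
  · exact fun h A hA x =>
      ⟨(h _ x).1 (hmono A hA _ (Set.subset_preimage_image (op x) A)), (h A x).2 hA⟩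

theorem isIH_principal (x : X) : IsIH {B : Set X | x ∈ B} :=
  ⟨⟨{x}, rfl⟩, fun _ hA => ⟨x, hA⟩, fun _ hA _ hAB => hAB hA⟩

theorem IsIH.setOf_const_mem_iff {𝒝 : Set (Set X)} (h𝒝 : IsIH 𝒝) (p : Prop) :
    {_x : X | p} ∈ 𝒝 ↔ p := by
  obtain ⟨⟨B, hB⟩, hne, hmono⟩ := h𝒝
  exact ⟨fun h => (hne _ h).choose_spec, fun h => hmono B hB _ fun _ _ => h⟩

theorem stmt10 (op : X → X → X) (𝒜 : Set (Set X)) (h𝒜 : IsIH 𝒜) :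
    (∀ 𝒝 : Set (Set X), IsIH 𝒝 → circ op 𝒝 𝒜 = 𝒜) ↔ ShiftInv op 𝒜 := by
  rw [shiftInv_iff_forall_preimage_mem_iff op 𝒜 h𝒜]
  constructor
  · exact fun h A x => Set.ext_iff.1 (h _ (isIH_principal x)) A
  · intro h 𝒝 h𝒝
    ext A
    simp only [circ, Set.mem_ofPred_eq, h]
    exact h𝒝.setOf_const_mem_iff (A ∈ 𝒜)
end

section
/- Let X be a set with a binary operation * and let ↔G(X) denote the set of all shift-invariant inclusion hyperspaces on X. Then: (1) 𝒜 ∘ 𝒝 = 𝒝 for all 𝒜, 𝒝 ∈ ↔G(X) (so ↔G(X) is a rectangular semigroup under ∘); (2) if 𝒜 ∈ ↔G(X) then 𝒜⊥ ∈ ↔G(X); (3) the union and the intersection of any nonempty family of shift-invariant inclusion hyperspaces are shift-invariant inclusion hyperspaces; (4) if ↔G(X) is nonempty, then ↔G(X) is a left ideal of the groupoid of inclusion hyperspaces under ∘ and is contained in every right ideal of this groupoid. -/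
variable {X : Type*}

theorem IsIH.univ_mem {𝒜 : Set (Set X)} (h : IsIH 𝒜) : Set.univ ∈ 𝒜 := by
  obtain ⟨A, hA⟩ := h.1
  exact h.2.2 A hA _ (Set.subset_univ A)

theorem ShiftInv.preimage_mem_iff {op : X → X → X} {𝒝 : Set (Set X)} (hB : IsIH 𝒝)
    (hs : ShiftInv op 𝒝) (x : X) (A : Set X) : {y | op x y ∈ A} ∈ 𝒝 ↔ A ∈ 𝒝 :=
  ⟨fun h => hB.2.2 _ (hs _ h x).1 A (Set.image_preimage_subset (op x) A), fun h => (hs A h x).2⟩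

/-- A shift-invariant inclusion hyperspace is a right zero for all inclusion hyperspaces. -/
theorem circ_eq_right {op : X → X → X} {𝒜 𝒝 : Set (Set X)} (hA : IsIH 𝒜) (hB : IsIH 𝒝)
    (hs : ShiftInv op 𝒝) : circ op 𝒜 𝒝 = 𝒝 := by
  ext A
  simp only [circ, Set.mem_ofPred_eq, hs.preimage_mem_iff hB]
  constructor
  · intro h
    obtain ⟨_, hx⟩ := hA.2.1 _ h
    exact hx
  · intro h
    simpa [h] using hA.univ_mem

theorem IsIH.perp {𝒜 : Set (Set X)} (h : IsIH 𝒜) : IsIH (perp 𝒜) := by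
  refine ⟨⟨Set.univ, fun B hB => by simpa using h.2.1 B hB⟩, fun A hA => ?_,
    fun A hA B hAB C hC => ?_⟩
  · obtain ⟨B, hB⟩ := h.1
    exact (hA B hB).mono Set.inter_subset_left
  · exact (hA C hC).mono (Set.inter_subset_inter_left C hAB)

theorem ShiftInv.perp {op : X → X → X} {𝒜 : Set (Set X)} (hs : ShiftInv op 𝒜) :
    ShiftInv op (perp 𝒜) := by
  intro A hA x
  constructor
  · intro B hB
    obtain ⟨y, hyA, hyB⟩ := hA _ (hs B hB x).2
    exact ⟨op x y, ⟨y, hyA, rfl⟩, hyB⟩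
  · intro B hB
    obtain ⟨_, hzA, y, hyB, rfl⟩ := hA _ (hs B hB x).1
    exact ⟨y, hzA, hyB⟩

theorem IsIH.iUnion {ι : Sort*} [Nonempty ι] {Z : ι → Set (Set X)} (h : ∀ i, IsIH (Z i)) :
    IsIH (⋃ i, Z i) := by
  refine ⟨⟨Set.univ, Set.mem_iUnion.2 ⟨Classical.arbitrary ι, (h _).univ_mem⟩⟩, ?_, ?_⟩
  · intro A hA
    obtain ⟨i, hi⟩ := Set.mem_iUnion.1 hA
    exact (h i).2.1 A hi
  · intro A hA B hAB
    obtain ⟨i, hi⟩ := Set.mem_iUnion.1 hA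
    exact Set.mem_iUnion.2 ⟨i, (h i).2.2 A hi B hAB⟩

theorem IsIH.iInter {ι : Sort*} [Nonempty ι] {Z : ι → Set (Set X)} (h : ∀ i, IsIH (Z i)) :
    IsIH (⋂ i, Z i) := by
  refine ⟨⟨Set.univ, Set.mem_iInter.2 fun i => (h i).univ_mem⟩, ?_, ?_⟩
  · intro A hA
    exact (h (Classical.arbitrary ι)).2.1 A (Set.mem_iInter.1 hA _)
  · intro A hA B hAB
    exact Set.mem_iInter.2 fun i => (h i).2.2 A (Set.mem_iInter.1 hA i) B hAB

theorem ShiftInv.iUnion {op : X → X → X} {ι : Sort*} {Z : ι → Set (Set X)}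
    (h : ∀ i, ShiftInv op (Z i)) : ShiftInv op (⋃ i, Z i) := by
  intro A hA x
  obtain ⟨i, hi⟩ := Set.mem_iUnion.1 hA
  exact ⟨Set.mem_iUnion.2 ⟨i, (h i A hi x).1⟩, Set.mem_iUnion.2 ⟨i, (h i A hi x).2⟩⟩

theorem ShiftInv.iInter {op : X → X → X} {ι : Sort*} {Z : ι → Set (Set X)}
    (h : ∀ i, ShiftInv op (Z i)) : ShiftInv op (⋂ i, Z i) := fun A hA x =>
  ⟨Set.mem_iInter.2 fun i => (h i A (Set.mem_iInter.1 hA i) x).1,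
    Set.mem_iInter.2 fun i => (h i A (Set.mem_iInter.1 hA i) x).2⟩

theorem stmt11 (op : X → X → X) :
    -- (1) shift-invariant inclusion hyperspaces form a rectangular semigroup
    (∀ 𝒜 𝒝 : Set (Set X), IsIH 𝒜 → ShiftInv op 𝒜 → IsIH 𝒝 → ShiftInv op 𝒝 →
      circ op 𝒜 𝒝 = 𝒝) ∧
    -- (2) closedness under transversality
    (∀ 𝒜 : Set (Set X), IsIH 𝒜 → ShiftInv op 𝒜 →
      IsIH (perp 𝒜) ∧ ShiftInv op (perp 𝒜)) ∧
    -- (3) closedness under nonempty unions and intersections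
    (∀ (I : Type) (Z : I → Set (Set X)), Nonempty I →
      (∀ i, IsIH (Z i) ∧ ShiftInv op (Z i)) →
      (IsIH (⋃ i, Z i) ∧ ShiftInv op (⋃ i, Z i)) ∧
      (IsIH (⋂ i, Z i) ∧ ShiftInv op (⋂ i, Z i))) ∧
    -- (4) if nonempty, a left ideal contained in every right ideal
    ((∃ 𝒜 : Set (Set X), IsIH 𝒜 ∧ ShiftInv op 𝒜) →
      (∀ 𝒜 𝒝 : Set (Set X), IsIH 𝒜 → IsIH 𝒝 → ShiftInv op 𝒝 →
        IsIH (circ op 𝒜 𝒝) ∧ ShiftInv op (circ op 𝒜 𝒝)) ∧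
      (∀ I : Set (Set (Set X)), I.Nonempty → (∀ 𝒜 ∈ I, IsIH 𝒜) →
        (∀ 𝒜 ∈ I, ∀ 𝒝 : Set (Set X), IsIH 𝒝 → circ op 𝒜 𝒝 ∈ I) →
        ∀ 𝒞 : Set (Set X), IsIH 𝒞 → ShiftInv op 𝒞 → 𝒞 ∈ I)) := by
  refine ⟨fun 𝒜 𝒝 hA _ hB hs => circ_eq_right hA hB hs, fun 𝒜 hA hs => ⟨hA.perp, hs.perp⟩,
    fun I Z _ hZ => ?_, fun _ => ⟨fun 𝒜 𝒝 hA hB hs => ?_, fun I hne hI hr 𝒞 hC hs => ?_⟩⟩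
  · exact ⟨⟨IsIH.iUnion fun i => (hZ i).1, ShiftInv.iUnion fun i => (hZ i).2⟩,
      IsIH.iInter fun i => (hZ i).1, ShiftInv.iInter fun i => (hZ i).2⟩
  · rw [circ_eq_right hA hB hs]
    exact ⟨hB, hs⟩
  · obtain ⟨𝒜, hA⟩ := hne
    simpa only [circ_eq_right (hI 𝒜 hA) hC hs] using hr 𝒜 hA 𝒞 hC
end

section
/- Let X be a set with a binary operation * and suppose there is a surjective map h : X → ℤ/3ℤ such that h(x*y) = h(x) + h(y) for all x, y ∈ X. Let λ(X) denote the set of maximal linked inclusion hyperspaces on X, which is closed under the induced operation ∘. Then every minimal left ideal I of (λ(X), ∘) is disjoint from the set of ultrafilters on X; that is, no element of I is an ultrafilter. -/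
variable {X : Type*}

/-- The set `λ(X)` of maximal linked inclusion hyperspaces. -/
def lambdaX : Set (Set (Set X)) := {𝒜 | IsIH 𝒜 ∧ IsMaxLinked 𝒜}

/-- A maximal linked inclusion hyperspace contains every set or its complement. -/
theorem mem_or_compl_mem_of_mem_lambdaX {ℬ : Set (Set X)} (hℬ : ℬ ∈ (lambdaX : Set (Set (Set X))))
    (A : Set X) : A ∈ ℬ ∨ Aᶜ ∈ ℬ := by
  obtain ⟨⟨⟨B₀, hB₀⟩, hne, hup⟩, hlink, hmax⟩ := hℬ
  by_cases hA : ∀ B ∈ ℬ, (A ∩ B).Nonempty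
  · have hAne : A.Nonempty := (hA B₀ hB₀).mono Set.inter_subset_left
    have heq : ℬ = ℬ ∪ {C | A ⊆ C} := by
      refine hmax _ ⟨⟨B₀, Or.inl hB₀⟩, ?_, ?_⟩ ?_ Set.subset_union_left
      · rintro C (hC | hC)
        exacts [hne C hC, hAne.mono hC]
      · rintro C (hC | hC) D hCD
        exacts [Or.inl (hup C hC D hCD), Or.inr (hC.trans hCD)]
      · rintro C (hC | hC) D (hD | hD)
        · exact hlink C hC D hD
        · rw [Set.inter_comm]
          exact (hA C hC).mono (Set.inter_subset_inter_left C hD)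
        · exact (hA D hD).mono (Set.inter_subset_inter_left D hC)
        · exact hAne.mono (Set.subset_inter hC hD)
    left
    rw [heq]
    exact Or.inr (Set.Subset.refl A)
  · push Not at hA
    obtain ⟨B, hB, hAB⟩ := hA
    exact Or.inr (hup B hB _ fun x hx hxA => Set.notMem_empty x (hAB ▸ ⟨hxA, hx⟩))

/-- The sets containing at least two of the three values of a map `s : ZMod 3 → X`. -/
def majority (s : ZMod 3 → X) : Set (Set X) := {A | ∃ c, ∀ d, d ≠ c → s d ∈ A}

theorem majority_mem_lambdaX (s : ZMod 3 → X) :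
    majority s ∈ (lambdaX : Set (Set (Set X))) := by
  have hthird : ∀ a b : ZMod 3, ∃ d, d ≠ a ∧ d ≠ b := by decide
  have hlink : IsLinked (majority s) := by
    rintro A ⟨a, ha⟩ B ⟨b, hb⟩
    obtain ⟨d, hda, hdb⟩ := hthird a b
    exact ⟨s d, ha d hda, hb d hdb⟩
  refine ⟨⟨⟨Set.univ, 0, fun _ _ => trivial⟩, fun A hA => ?_, ?_⟩, hlink, ?_⟩
  · simpa using hlink A hA A hA
  · rintro A ⟨a, ha⟩ B hAB
    exact ⟨a, fun d hd => hAB (ha d hd)⟩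
  · intro 𝒜 _ hlink' hsub
    refine hsub.antisymm fun A hA => ?_
    have hAmeets : ∀ c, ∃ d, d ≠ c ∧ s d ∈ A := by
      intro c
      obtain ⟨_, hxA, d, hd, rfl⟩ :=
        hlink' A hA (s '' {d | d ≠ c}) (hsub ⟨c, fun d hd => ⟨d, hd, rfl⟩⟩)
      exact ⟨d, hd, hxA⟩
    obtain ⟨d, -, hdA⟩ := hAmeets 0
    obtain ⟨e, hed, heA⟩ := hAmeets d
    obtain ⟨c, hcd, hce⟩ := hthird d e
    have hcover : ∀ c d e f : ZMod 3, e ≠ d → c ≠ d → c ≠ e → f ≠ c → f = d ∨ f = e := by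
      decide
    refine ⟨c, fun f hf => ?_⟩
    rcases hcover c d e f hed hcd hce hf with rfl | rfl
    exacts [hdA, heA]

theorem stmt14 (op : X → X → X) (h : X → ZMod 3)
    (hsurj : Function.Surjective h)
    (hhom : ∀ x y : X, h (op x y) = h x + h y)
    (I : Set (Set (Set X)))
    (hIsub : I ⊆ lambdaX) (hIne : I.Nonempty)
    (hIleft : ∀ 𝒜 ∈ (lambdaX : Set (Set (Set X))), ∀ 𝒝 ∈ I, circ op 𝒜 𝒝 ∈ I)
    (hImin : ∀ J : Set (Set (Set X)), J ⊆ I → J.Nonempty →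
      (∀ 𝒜 ∈ (lambdaX : Set (Set (Set X))), ∀ 𝒝 ∈ J, circ op 𝒜 𝒝 ∈ J) → J = I) :
    ∀ 𝒝 ∈ I, ¬ IsUltraIH 𝒝 := by
  -- `J` consists of the elements of `I` whose image in `λ(ZMod 3)` is the zero of that semigroup.
  let J : Set (Set (Set X)) := {ℬ ∈ I | ∀ c, {y | h y ≠ c} ∈ ℬ}
  have hshift : ∀ (c : ZMod 3) (x : X), {y | op x y ∈ {z | h z ≠ c}} = {y | h y ≠ c - h x} := by
    intro c x
    ext y
    simp only [Set.mem_ofPred_eq, hhom, ne_eq, eq_sub_iff_add_eq']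
  have hJleft : ∀ 𝒜 ∈ (lambdaX : Set (Set (Set X))), ∀ ℬ ∈ J, circ op 𝒜 ℬ ∈ J := by
    rintro 𝒜 h𝒜 ℬ ⟨hℬI, hℬ⟩
    refine ⟨hIleft 𝒜 h𝒜 ℬ hℬI, fun c => ?_⟩
    obtain ⟨⟨⟨A, hA⟩, -, hup⟩, -⟩ := h𝒜
    refine hup A hA _ fun x _ => ?_
    rw [Set.mem_ofPred_eq, hshift]
    exact hℬ _
  have hJne : J.Nonempty := by
    obtain ⟨ℬ, hℬI⟩ := hIne
    obtain ⟨s, hs⟩ := hsurj.hasRightInverse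
    refine ⟨_, hIleft _ (majority_mem_lambdaX s) ℬ hℬI, fun c => ?_⟩
    have htwo : ∃ b, ∀ d, d ≠ b → {y | h y ≠ d} ∈ ℬ := by
      by_cases hall : ∀ d, {y | h y ≠ d} ∈ ℬ
      · exact ⟨0, fun d _ => hall d⟩
      · push Not at hall
        obtain ⟨b, hb⟩ := hall
        have hfib := (mem_or_compl_mem_of_mem_lambdaX (hIsub hℬI) _).resolve_left hb
        refine ⟨b, fun d hd => (hIsub hℬI).1.2.2 _ hfib _ fun y hy hyd => hy fun hyb => hd ?_⟩
        exact hyd.symm.trans hyb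
    obtain ⟨b, hb⟩ := htwo
    refine ⟨c - b, fun d hd => ?_⟩
    rw [Set.mem_ofPred_eq, hshift, hs d]
    exact hb _ fun hcd => hd (by rw [← hcd, sub_sub_cancel])
  have hJI : J = I := hImin J (Set.sep_subset _ _) hJne hJleft
  intro ℬ hℬ hultra
  have hmem : ∀ c, {y | h y ≠ c} ∈ ℬ := (hJI ▸ hℬ : ℬ ∈ J).2
  obtain ⟨y, ⟨h0, h1⟩, h2⟩ := (hIsub hℬ).1.2.1 _
    (hultra.1 _ (hultra.1 _ (hmem 0) _ (hmem 1)) _ (hmem 2))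
  have hcases : ∀ a : ZMod 3, a ≠ 0 → a ≠ 1 → a ≠ 2 → False := by decide
  exact hcases (h y) h0 h1 h2
end

section
/- Let X be a nonempty quasigroup with operation *. If an inclusion hyperspace 𝒞 on X commutes (with respect to the induced operation ∘) with both the maximal inclusion hyperspace consisting of all nonempty subsets of X and the minimal inclusion hyperspace {X}, then 𝒞 is a principal ultrafilter, i.e. 𝒞 = ⟨c⟩ for some c ∈ X. -/
variable {X : Type*}

/-- The principal ultrafilter generated by a point. -/
def principal (a : X) : Set (Set X) := {A | a ∈ A}

/-- `op` is a quasigroup operation: all equations `a*x = b` and `y*a = b` are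
uniquely solvable. -/
def IsQuasigroup (op : X → X → X) : Prop :=
  ∀ a b : X, (∃! x : X, op a x = b) ∧ (∃! y : X, op y a = b)

theorem stmt15 [Nonempty X] (op : X → X → X) (hq : IsQuasigroup op)
    (𝒞 : Set (Set X)) (h𝒞 : IsIH 𝒞)
    (hmax : circ op 𝒞 {A : Set X | A.Nonempty} = circ op {A : Set X | A.Nonempty} 𝒞)
    (hmin : circ op 𝒞 ({Set.univ} : Set (Set X)) = circ op ({Set.univ} : Set (Set X)) 𝒞) :
    ∃ c : X, 𝒞 = principal c := by
  obtain ⟨hne, hnonempty, hmono⟩ := h𝒞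
  have huniv : Set.univ ∈ 𝒞 := by
    obtain ⟨A, hA⟩ := hne
    exact hmono A hA _ (Set.subset_univ A)
  obtain ⟨a⟩ := ‹Nonempty X›
  obtain ⟨c, hc⟩ : ∃ c, {c} ∈ 𝒞 := by
    have hmem : ({a} : Set X) ∈ circ op 𝒞 {A : Set X | A.Nonempty} :=
      hmono _ huniv _ fun x _ => (hq x a).1.exists
    rw [hmax] at hmem
    obtain ⟨x, hx⟩ := hmem
    obtain ⟨c, -, hc⟩ := (hq x a).1
    exact ⟨c, hmono _ hx _ fun y hy => hc y hy⟩
  refine ⟨c, Set.Subset.antisymm (fun C hC => ?_)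
    fun A hA => hmono _ hc A (Set.singleton_subset_iff.2 hA)⟩
  by_contra hcC
  have hmem : ({op a c}ᶜ : Set X) ∈ circ op ({Set.univ} : Set (Set X)) 𝒞 := by
    refine Set.eq_univ_of_forall fun x => ?_
    by_cases hx : op x c = op a c
    · refine hmono C hC _ fun y hy hxy => hcC ?_
      have hyc : y = c := (hq x (op a c)).1.unique hxy hx
      exact hyc ▸ hy
    · exact hmono _ hc _ (Set.singleton_subset_iff.2 hx)
  rw [← hmin] at hmem
  obtain ⟨x, hx⟩ := hnonempty _ hmem
  obtain ⟨y, hy, -⟩ := (hq x (op a c)).1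
  exact (Set.eq_univ_iff_forall.1 hx y) hy
end

section
/- Let X be a nonempty quasigroup with operation *. An inclusion hyperspace 𝒞 on X satisfies 𝒞 ∘ 𝒻 = 𝒻 ∘ 𝒞 for every inclusion hyperspace 𝒻 on X if and only if 𝒞 = ⟨c⟩ is the principal ultrafilter of an element c belonging to the center of X (i.e. c*x = x*c for all x ∈ X). In other words, the center of the groupoid of inclusion hyperspaces under ∘ coincides with the center of X. -/
variable {X : Type*}

theorem isIH_principal_s16 (a : X) : IsIH (principal a) :=
  ⟨⟨Set.univ, Set.mem_univ a⟩, fun _ h => ⟨a, h⟩, fun _ h _ hAB => hAB h⟩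

theorem isIH_singleton_univ [Nonempty X] : IsIH ({Set.univ} : Set (Set X)) := by
  refine ⟨⟨Set.univ, rfl⟩, ?_, ?_⟩
  · rintro A rfl
    exact Set.univ_nonempty
  · rintro A rfl B hB
    exact Set.univ_subset_iff.mp hB

theorem isIH_setOf_nonempty [Nonempty X] : IsIH {A : Set X | A.Nonempty} :=
  ⟨⟨Set.univ, Set.univ_nonempty⟩, fun _ h => h, fun _ h _ hAB => Set.Nonempty.mono hAB h⟩

/-- An inclusion hyperspace commuting with the largest one contains a singleton. -/
theorem exists_singleton_mem [Nonempty X] {op : X → X → X} (hq : IsQuasigroup op)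
    {𝒞 : Set (Set X)} (h𝒞 : IsIH 𝒞)
    (h : circ op 𝒞 {A | A.Nonempty} = circ op {A | A.Nonempty} 𝒞) :
    ∃ c : X, {c} ∈ 𝒞 := by
  obtain ⟨b⟩ := ‹Nonempty X›
  have hb : ({b} : Set X) ∈ circ op 𝒞 {A | A.Nonempty} := by
    obtain ⟨S, hS⟩ := h𝒞.1
    refine h𝒞.2.2 S hS _ fun x _ => ?_
    obtain ⟨y, hy, -⟩ := (hq x b).1
    exact ⟨y, hy⟩
  rw [h] at hb
  obtain ⟨x, hx⟩ := hb
  obtain ⟨c, -, hc⟩ := (hq x b).1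
  exact ⟨c, h𝒞.2.2 _ hx _ fun y hy => hc y hy⟩

/-- An inclusion hyperspace commuting with the smallest one lies in a principal ultrafilter. -/
theorem exists_subset_principal [Nonempty X] {op : X → X → X} (hq : IsQuasigroup op)
    {𝒞 : Set (Set X)} (h𝒞 : IsIH 𝒞)
    (h : circ op 𝒞 {Set.univ} = circ op {Set.univ} 𝒞) :
    ∃ c : X, 𝒞 ⊆ principal c := by
  obtain ⟨b⟩ := ‹Nonempty X›
  have hb : ({b}ᶜ : Set X) ∉ circ op {Set.univ} 𝒞 := by
    rw [← h]
    intro hmem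
    obtain ⟨x, hx⟩ := h𝒞.2.1 _ hmem
    obtain ⟨y, hy, -⟩ := (hq x b).1
    have hxy : y ∈ {y | op x y ∈ ({b}ᶜ : Set X)} := by
      rw [show {y | op x y ∈ ({b}ᶜ : Set X)} = Set.univ from hx]
      trivial
    exact hxy hy
  obtain ⟨x, hx⟩ := (Set.ne_univ_iff_exists_notMem _).mp hb
  obtain ⟨c, -, hc⟩ := (hq x b).1
  refine ⟨c, fun A hA => ?_⟩
  by_contra hcA
  refine hx (h𝒞.2.2 A hA _ fun y hy hyb => hcA ?_)
  exact hc y hyb ▸ hy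

theorem stmt16 [Nonempty X] (op : X → X → X) (hq : IsQuasigroup op)
    (𝒞 : Set (Set X)) (h𝒞 : IsIH 𝒞) :
    (∀ ℱ : Set (Set X), IsIH ℱ → circ op 𝒞 ℱ = circ op ℱ 𝒞) ↔
    ∃ c : X, (∀ x : X, op c x = op x c) ∧ 𝒞 = principal c := by
  constructor
  · intro h
    obtain ⟨c, hc⟩ := exists_singleton_mem hq h𝒞 (h _ isIH_setOf_nonempty)
    obtain ⟨d, hd⟩ := exists_subset_principal hq h𝒞 (h _ isIH_singleton_univ)
    obtain rfl : d = c := hd hc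
    obtain rfl : 𝒞 = principal d := hd.antisymm fun A hA =>
      h𝒞.2.2 _ hc _ (Set.singleton_subset_iff.mpr hA)
    refine ⟨d, fun x => ?_, rfl⟩
    have hx : ({op x d} : Set X) ∈ circ op (principal x) (principal d) :=
      show op x d ∈ ({op x d} : Set X) from rfl
    rw [← h _ (isIH_principal_s16 x)] at hx
    exact hx
  · rintro ⟨c, hc, rfl⟩ ℱ -
    ext A
    change {y | op c y ∈ A} ∈ ℱ ↔ {x | op x c ∈ A} ∈ ℱ
    simp only [hc]
end

section
/- Let X be a nonempty quasigroup with operation *. An inclusion hyperspace 𝒻 on X is left cancelable with respect to the induced operation ∘ (that is, for all inclusion hyperspaces 𝒰, 𝒱 on X, 𝒻 ∘ 𝒰 = 𝒻 ∘ 𝒱 implies 𝒰 = 𝒱) if and only if 𝒻 is a principal ultrafilter ⟨c⟩ for some c ∈ X. -/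
variable {X : Type*}

theorem principal_of_subsingleton [Subsingleton X] {ℱ : Set (Set X)} (hℱ : IsIH ℱ) (c : X) :
    ℱ = principal c := by
  obtain ⟨⟨B, hB⟩, hne, hmono⟩ := hℱ
  ext A
  constructor
  · intro hA
    obtain ⟨a, ha⟩ := hne A hA
    exact Subsingleton.elim a c ▸ ha
  · intro hA
    exact hmono B hB A fun y _ => Subsingleton.elim c y ▸ hA

/-- Composition with a principal ultrafilter on the left is injective. -/
theorem circ_principal_injective {op : X → X → X} (hq : IsQuasigroup op) (c : X) :
    Function.Injective (circ op (principal c)) := by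
  intro 𝒰 𝒱 h
  ext A
  have hA : {y | op c y ∈ op c '' A} = A := by
    ext y
    constructor
    · rintro ⟨z, hz, hzy⟩
      exact (hq c (op c y)).1.unique hzy rfl ▸ hz
    · exact fun hy => ⟨y, hy, rfl⟩
  have key : {y | op c y ∈ op c '' A} ∈ 𝒰 ↔ {y | op c y ∈ op c '' A} ∈ 𝒱 :=
    Set.ext_iff.mp h (op c '' A)
  rwa [hA] at key

/-- A left cancelable inclusion hyperspace contains a singleton. -/
theorem exists_singleton_mem_of_cancel [Nontrivial X] {op : X → X → X} (hq : IsQuasigroup op)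
    {ℱ : Set (Set X)} (hℱ : IsIH ℱ)
    (hc : ∀ 𝒰 𝒱 : Set (Set X), IsIH 𝒰 → IsIH 𝒱 → circ op ℱ 𝒰 = circ op ℱ 𝒱 → 𝒰 = 𝒱) :
    ∃ c : X, {c} ∈ ℱ := by
  by_contra! hno
  obtain ⟨x₀, x₁, hx⟩ := exists_pair_ne X
  have hU : IsIH {A : Set X | ∀ y, y ∈ A} :=
    ⟨⟨Set.univ, fun _ => trivial⟩, fun A hA => ⟨x₀, hA x₀⟩, fun A hA B hAB y => hAB (hA y)⟩
  have hV : IsIH {A : Set X | ∀ y, y ≠ x₀ → y ∈ A} :=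
    ⟨⟨Set.univ, fun _ _ => trivial⟩, fun A hA => ⟨x₁, hA x₁ hx.symm⟩,
      fun A hA B hAB y hy => hAB (hA y hy)⟩
  have heq := hc _ _ hU hV (by
    ext A
    constructor
    · exact fun hA => hℱ.2.2 _ hA _ fun x hxA y _ => hxA y
    · intro hA
      have hall : ∀ a, a ∈ A := by
        intro a
        by_contra ha
        obtain ⟨x, -, hxu⟩ := (hq x₀ a).2
        refine hno x (hℱ.2.2 _ hA _ fun z hz => hxu z ?_)
        obtain ⟨w, hw, -⟩ := (hq z a).1
        have hwx : w = x₀ := by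
          by_contra hne
          have hmem : op z w ∈ A := hz w hne
          exact ha (hw ▸ hmem)
        exact hwx ▸ hw
      exact hℱ.2.2 _ hA _ fun x _ y => hall _)
  have hmem : {x₀}ᶜ ∈ {A : Set X | ∀ y, y ∈ A} := heq ▸ fun y hy => hy
  exact hmem x₀ rfl

/-- A left cancelable inclusion hyperspace containing `{c}` does not contain its complement. -/
theorem compl_singleton_notMem_of_cancel [Nontrivial X] {op : X → X → X} (hq : IsQuasigroup op)
    {ℱ : Set (Set X)} (hℱ : IsIH ℱ)
    (hc : ∀ 𝒰 𝒱 : Set (Set X), IsIH 𝒰 → IsIH 𝒱 → circ op ℱ 𝒰 = circ op ℱ 𝒱 → 𝒰 = 𝒱)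
    {c : X} (hcF : {c} ∈ ℱ) : {c}ᶜ ∉ ℱ := by
  intro hcompl
  obtain ⟨x₀, x₁, hx⟩ := exists_pair_ne X
  have hU : IsIH {A : Set X | A.Nonempty} :=
    ⟨⟨Set.univ, x₀, trivial⟩, fun A hA => hA, fun A hA B hAB => hA.mono hAB⟩
  have hV : IsIH {A : Set X | ∃ y ∈ A, y ≠ x₀} :=
    ⟨⟨Set.univ, x₁, trivial, hx.symm⟩, fun A ⟨y, hy, _⟩ => ⟨y, hy⟩,
      fun A ⟨y, hy, hne⟩ B hAB => ⟨y, hAB hy, hne⟩⟩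
  have heq := hc _ _ hU hV (by
    ext A
    constructor
    · intro hA
      obtain ⟨x, y, ha⟩ := hℱ.2.1 _ hA
      obtain ⟨x', -, hxu⟩ := (hq x₀ (op x y)).2
      have hsub : ∀ z, z ≠ x' → ∃ w ∈ {w | op z w ∈ A}, w ≠ x₀ := by
        intro z hz
        obtain ⟨w, hw, -⟩ := (hq z (op x y)).1
        refine ⟨w, (congrArg (· ∈ A) hw).mpr ha, fun hwx => hz (hxu z (hwx ▸ hw))⟩
      by_cases hcx : c = x'
      · exact hℱ.2.2 _ hcompl _ fun z hz => hsub z fun h => hz (h.trans hcx.symm)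
      · refine hℱ.2.2 _ hcF _ fun z hz => hsub z fun h => hcx ?_
        exact (Set.mem_singleton_iff.mp hz).symm.trans h
    · exact fun hA => hℱ.2.2 _ hA _ fun x ⟨y, hy, _⟩ => ⟨y, hy⟩)
  have hmem : {x₀} ∈ {A : Set X | ∃ y ∈ A, y ≠ x₀} := heq ▸ Set.singleton_nonempty x₀
  obtain ⟨y, hy, hne⟩ := hmem
  exact hne hy

theorem stmt17 [Nonempty X] (op : X → X → X) (hq : IsQuasigroup op)
    (ℱ : Set (Set X)) (hℱ : IsIH ℱ) :
    (∀ 𝒰 𝒱 : Set (Set X), IsIH 𝒰 → IsIH 𝒱 →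
      circ op ℱ 𝒰 = circ op ℱ 𝒱 → 𝒰 = 𝒱) ↔
    ∃ c : X, ℱ = principal c := by
  constructor
  · intro hc
    rcases subsingleton_or_nontrivial X with _ | _
    · exact ⟨Classical.arbitrary X, principal_of_subsingleton hℱ _⟩
    · obtain ⟨c, hcF⟩ := exists_singleton_mem_of_cancel hq hℱ hc
      refine ⟨c, Set.Subset.antisymm (fun A hA => ?_) fun A hA => ?_⟩
      · by_contra hcA
        exact compl_singleton_notMem_of_cancel hq hℱ hc hcF
          (hℱ.2.2 A hA _ (Set.subset_compl_singleton_iff.mpr hcA))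
      · exact hℱ.2.2 _ hcF A (Set.singleton_subset_iff.mpr hA)
  · rintro ⟨c, rfl⟩ 𝒰 𝒱 - - h
    exact circ_principal_injective hq c h
end

section
/- Let X be a set with a binary operation * and let 𝒻 be an inclusion hyperspace on X. Suppose there exists a family of sets (S_x)_{x∈X} such that S_x ∈ 𝒻 ∩ 𝒻⊥ for every x ∈ X and x*S_x ∩ y*S_y = ∅ for any distinct x, y ∈ X. Then 𝒻 is right cancelable with respect to the induced operation ∘: for all inclusion hyperspaces 𝒜, 𝒝 on X, 𝒜 ∘ 𝒻 = 𝒝 ∘ 𝒻 implies 𝒜 = 𝒝. -/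
variable {X : Type*}

/-- Every set is recovered from the union of the translates `x * S x` of its points. -/
theorem setOf_preimage_iUnion_mem_eq (op : X → X → X) {ℱ : Set (Set X)}
    (hmono : ∀ A ∈ ℱ, ∀ B : Set X, A ⊆ B → B ∈ ℱ)
    {S : X → Set X} (hS : ∀ x : X, S x ∈ ℱ ∧ S x ∈ perp ℱ)
    (hdisj : ∀ x y : X, x ≠ y → (op x) '' (S x) ∩ (op y) '' (S y) = ∅) (A : Set X) :
    {x | {y | op x y ∈ ⋃ a ∈ A, (op a) '' (S a)} ∈ ℱ} = A := by
  ext x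
  refine ⟨fun hx => ?_, fun hx => ?_⟩
  · obtain ⟨y, hyS, hy⟩ := (hS x).2 _ hx
    obtain ⟨a, ha, hya⟩ := Set.mem_iUnion₂.1 hy
    by_contra hxA
    have hne : x ≠ a := fun h => hxA (h ▸ ha)
    exact (hdisj x a hne).subset ⟨Set.mem_image_of_mem _ hyS, hya⟩
  · exact hmono _ (hS x).1 _ fun y hy =>
      Set.mem_iUnion₂.2 ⟨x, hx, Set.mem_image_of_mem _ hy⟩

theorem stmt18 (op : X → X → X) (ℱ : Set (Set X)) (hℱ : IsIH ℱ)
    (S : X → Set X) (hS : ∀ x : X, S x ∈ ℱ ∧ S x ∈ perp ℱ)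
    (hdisj : ∀ x y : X, x ≠ y → (op x) '' (S x) ∩ (op y) '' (S y) = ∅) :
    ∀ 𝒜 𝒝 : Set (Set X), IsIH 𝒜 → IsIH 𝒝 →
      circ op 𝒜 ℱ = circ op 𝒝 ℱ → 𝒜 = 𝒝 := by
  intro 𝒜 𝒝 _ _ h
  ext A
  have hA := Set.ext_iff.1 h (⋃ a ∈ A, (op a) '' (S a))
  simpa only [circ, Set.mem_ofPred_eq, setOf_preimage_iUnion_mem_eq op hℱ.2.2 hS hdisj A] using hA
end

section
/- Let X be a countable set with a binary operation * and let 𝒰 be an inclusion hyperspace on X that is an ultrafilter. The following conditions are equivalent: (1) 𝒰 is right cancelable in the groupoid of all inclusion hyperspaces, i.e. for all inclusion hyperspaces 𝒜, 𝒝 on X, 𝒜 ∘ 𝒰 = 𝒝 ∘ 𝒰 implies 𝒜 = 𝒝; (2) 𝒰 is right cancelable among ultrafilters, i.e. for all ultrafilter inclusion hyperspaces 𝒜, 𝒝 on X, 𝒜 ∘ 𝒰 = 𝒝 ∘ 𝒰 implies 𝒜 = 𝒝; (3) there is an indexed family of sets (U_x)_{x∈X} with each U_x ∈ 𝒰 such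 that for any distinct x, y ∈ X the shifts x*U_x and y*U_y are disjoint. -/
variable {X : Type*}

theorem isIH_ultrafilter (F : Ultrafilter X) : IsIH {s | s ∈ F} :=
  ⟨⟨Set.univ, Filter.univ_mem⟩, fun _ hA => F.nonempty_of_mem hA,
    fun _ hA _ hAB => Filter.mem_of_superset hA hAB⟩

/-- A filter inclusion hyperspace is the family of sets of a proper filter. -/
theorem exists_filter_of_isFilterIH {𝒜 : Set (Set X)} (h : IsIH 𝒜) (hf : IsFilterIH 𝒜) :
    ∃ f : Filter X, f.NeBot ∧ ∀ s, s ∈ f ↔ s ∈ 𝒜 := by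
  obtain ⟨⟨A, hA⟩, hne, hmono⟩ := h
  let f : Filter X :=
    { sets := 𝒜
      univ_sets := hmono A hA _ (Set.subset_univ A)
      sets_of_superset := fun {s t} hs hst => hmono s hs t hst
      inter_sets := fun {s t} hs ht => hf s hs t ht }
  exact ⟨f, Filter.forall_mem_nonempty_iff_neBot.mp hne, fun _ => Iff.rfl⟩

theorem isUltraIH_ultrafilter (F : Ultrafilter X) : IsUltraIH {s | s ∈ F} := by
  refine ⟨fun _ h₁ _ h₂ => Filter.inter_mem h₁ h₂, fun 𝒜 h hf hle => ?_⟩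
  obtain ⟨f, hf, hmem⟩ := exists_filter_of_isFilterIH h hf
  have hfF : f ≤ F := fun s hs => (hmem s).mpr (hle hs)
  ext s
  rw [← hmem s, F.unique hfF]
  rfl

theorem IsUltraIH.exists_ultrafilter {𝒜 : Set (Set X)} (h : IsIH 𝒜) (hu : IsUltraIH 𝒜) :
    ∃ F : Ultrafilter X, 𝒜 = {s | s ∈ F} := by
  obtain ⟨f, hf, hmem⟩ := exists_filter_of_isFilterIH h hu.1
  exact ⟨Ultrafilter.of f, hu.2 _ (isIH_ultrafilter _) (isUltraIH_ultrafilter _).1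
    fun s hs => Ultrafilter.of_le f ((hmem s).mpr hs)⟩

/-- If the shifts of members of `𝒰` along some family are pairwise disjoint, then `𝒰` is right
cancelable among inclusion hyperspaces. -/
theorem subset_of_circ_eq_circ {op : X → X → X} {𝒰 𝒜 ℬ : Set (Set X)}
    (h𝒰 : IsIH 𝒰) (hf : IsFilterIH 𝒰) {U : X → Set X} (hU : ∀ x, U x ∈ 𝒰)
    (hd : ∀ x y, x ≠ y → Disjoint (op x '' U x) (op y '' U y))
    (h : circ op 𝒜 𝒰 = circ op ℬ 𝒰) : 𝒜 ⊆ ℬ := by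
  intro S hS
  have key : {x | {y | op x y ∈ ⋃ z ∈ S, op z '' U z} ∈ 𝒰} = S := by
    ext x
    refine ⟨fun hx => ?_, fun hx => h𝒰.2.2 _ (hU x) _ fun y hy =>
      Set.mem_biUnion hx (Set.mem_image_of_mem _ hy)⟩
    obtain ⟨y, hy, hyU⟩ := h𝒰.2.1 _ (hf _ hx _ (hU x))
    obtain ⟨z, hz, hyz⟩ := Set.mem_iUnion₂.mp hy
    by_contra hxS
    exact Set.disjoint_left.mp (hd x z fun e => hxS (e ▸ hz)) (Set.mem_image_of_mem _ hyU) hyz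
  have hmem : (⋃ z ∈ S, op z '' U z) ∈ circ op 𝒜 𝒰 := by
    change _ ∈ 𝒜
    rwa [key]
  rw [h] at hmem
  change _ ∈ ℬ at hmem
  rwa [key] at hmem

/-- If binding along `g` is injective on ultrafilters, then the family `g` is discrete. -/
theorem Ultrafilter.exists_mem_forall_notMem_of_bind_injective {α β : Type*}
    {g : α → Ultrafilter β}
    (h : Function.Injective fun F : Ultrafilter α => (F.bind g : Ultrafilter β)) (x : α) :
    ∃ s ∈ g x, ∀ y, y ≠ x → s ∉ g y := by
  rcases (Filter.comap g (nhds (g x)) ⊓ Filter.principal {x}ᶜ).eq_or_neBot with hbot | hne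
  · obtain ⟨t, ht, htx⟩ := Filter.mem_comap.mp (Filter.inf_principal_eq_bot.mp hbot)
    obtain ⟨_, ⟨s, rfl⟩, hs, hst⟩ := ultrafilterBasis_is_basis.mem_nhds_iff.mp ht
    exact ⟨s, hs, fun y hyx hy => htx (hst hy) hyx⟩
  · obtain ⟨H, hH⟩ := Ultrafilter.exists_le (Filter.comap g (nhds (g x)) ⊓ Filter.principal {x}ᶜ)
    obtain ⟨hHg, hHx⟩ := le_inf_iff.mp hH
    have hle : (H.bind g : Ultrafilter β) = (pure x : Ultrafilter α).bind g := by
      refine Ultrafilter.coe_le_coe.mp fun s hs => ?_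
      exact hHg (Filter.preimage_mem_comap ((ultrafilter_isOpen_basic s).mem_nhds hs))
    rw [h hle] at hHx
    exact absurd rfl (Filter.le_principal_iff.mp hHx)

/-- A countable discrete family of ultrafilters is strongly discrete. -/
theorem Ultrafilter.exists_pairwise_disjoint_mem {α β : Type*} [Countable α]
    {g : α → Ultrafilter β} (h : ∀ x, ∃ s ∈ g x, ∀ y, y ≠ x → s ∉ g y) :
    ∃ B : α → Set β, (∀ x, B x ∈ g x) ∧ Pairwise (Function.onFun Disjoint B) := by
  choose A hA hAy using h
  obtain ⟨e, he⟩ := exists_injective_nat α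
  refine ⟨fun x => A x ∩ ⋂ y ∈ {y | e y < e x}, (A y)ᶜ, fun x => ?_, fun x y hxy => ?_⟩
  · have hfin : {y | e y < e x}.Finite := (Set.finite_lt_nat (e x)).preimage he.injOn
    refine Filter.inter_mem (hA x) ((Filter.biInter_mem hfin).mpr fun y hy => ?_)
    refine Ultrafilter.compl_mem_iff_notMem.mpr (hAy y x ?_)
    rintro rfl
    exact lt_irrefl (e x) hy
  · refine Set.disjoint_left.mpr fun b hbx hby => ?_
    rcases lt_or_gt_of_ne (he.ne hxy) with hlt | hlt
    · exact Set.mem_iInter₂.mp hby.2 x hlt hbx.1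
    · exact Set.mem_iInter₂.mp hbx.2 y hlt hby.1

theorem stmt19 [Countable X] (op : X → X → X)
    (𝒰 : Set (Set X)) (h𝒰 : IsIH 𝒰) (hu : IsUltraIH 𝒰) :
    ((∀ 𝒜 𝒝 : Set (Set X), IsIH 𝒜 → IsIH 𝒝 →
        circ op 𝒜 𝒰 = circ op 𝒝 𝒰 → 𝒜 = 𝒝) ↔
      (∃ U : X → Set X, (∀ x : X, U x ∈ 𝒰) ∧
        ∀ x y : X, x ≠ y → Disjoint ((op x) '' (U x)) ((op y) '' (U y)))) ∧
    ((∀ 𝒜 𝒝 : Set (Set X), IsIH 𝒜 → IsUltraIH 𝒜 → IsIH 𝒝 → IsUltraIH 𝒝 →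
        circ op 𝒜 𝒰 = circ op 𝒝 𝒰 → 𝒜 = 𝒝) ↔
      (∃ U : X → Set X, (∀ x : X, U x ∈ 𝒰) ∧
        ∀ x y : X, x ≠ y → Disjoint ((op x) '' (U x)) ((op y) '' (U y)))) := by
  have h31 : (∃ U : X → Set X, (∀ x : X, U x ∈ 𝒰) ∧
      ∀ x y : X, x ≠ y → Disjoint ((op x) '' (U x)) ((op y) '' (U y))) →
      ∀ 𝒜 𝒝 : Set (Set X), IsIH 𝒜 → IsIH 𝒝 → circ op 𝒜 𝒰 = circ op 𝒝 𝒰 → 𝒜 = 𝒝 := by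
    rintro ⟨U, hU, hd⟩ 𝒜 ℬ _ _ h
    exact (subset_of_circ_eq_circ h𝒰 hu.1 hU hd h).antisymm
      (subset_of_circ_eq_circ h𝒰 hu.1 hU hd h.symm)
  have h23 : (∀ 𝒜 𝒝 : Set (Set X), IsIH 𝒜 → IsUltraIH 𝒜 → IsIH 𝒝 → IsUltraIH 𝒝 →
      circ op 𝒜 𝒰 = circ op 𝒝 𝒰 → 𝒜 = 𝒝) →
      ∃ U : X → Set X, (∀ x : X, U x ∈ 𝒰) ∧
        ∀ x y : X, x ≠ y → Disjoint ((op x) '' (U x)) ((op y) '' (U y)) := by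
    intro h
    obtain ⟨F, rfl⟩ := hu.exists_ultrafilter h𝒰
    have hinj : Function.Injective fun G : Ultrafilter X =>
        (G.bind fun x => F.map (op x) : Ultrafilter X) := by
      intro G H hGH
      have hc : circ op {s | s ∈ G} {s | s ∈ F} = circ op {s | s ∈ H} {s | s ∈ F} :=
        Set.ext fun s => Ultrafilter.ext_iff.mp hGH s
      exact Ultrafilter.ext fun s => Set.ext_iff.mp (h _ _ (isIH_ultrafilter G)
        (isUltraIH_ultrafilter G) (isIH_ultrafilter H) (isUltraIH_ultrafilter H) hc) s
    obtain ⟨B, hB, hd⟩ := Ultrafilter.exists_pairwise_disjoint_mem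
      (Ultrafilter.exists_mem_forall_notMem_of_bind_injective hinj)
    exact ⟨fun x => op x ⁻¹' B x, hB, fun x y hxy => (hd hxy).mono
      (Set.image_preimage_subset _ _) (Set.image_preimage_subset _ _)⟩
  exact ⟨⟨fun h => h23 fun 𝒜 ℬ h𝒜 _ hℬ _ => h 𝒜 ℬ h𝒜 hℬ, h31⟩,
    ⟨h23, fun h 𝒜 ℬ h𝒜 _ hℬ _ => h31 h 𝒜 ℬ h𝒜 hℬ⟩⟩
end
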